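/- Strong duality (Theorem 1): if the feasible set 𝓜ᵐᵐ is nonempty, then the supremum over Π ∈ 𝓜ᵐᵐ of f(Π) equals the infimum over dual feasible pairs (X, λ) (λ j ≥ 0 for all j, X Hermitian, and X - z m λ positive semidefinite for all m) of s(X, λ). -/

import Mathlib

open Matrix Complex
open scoped ComplexOrder

noncomputable section

/-- A POVM with `M` outcomes: each detection operator is positive semidefinite
and they sum to the identity. -/
def IsPOVM {n : Type*} [Fintype n] [DecidableEq n] {M : ℕ}
    (P : Fin M → Matrix n n ℂ) : Prop :=
  (∀ m, (P m).PosSemidef) ∧ ∑ m, P m = 1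

/-- Membership in the feasible set `𝓜ᵐᵐ`. -/
def Feasible {n : Type*} [Fintype n] [DecidableEq n] {M J : ℕ}
    (a : Fin J → Fin M → Matrix n n ℂ) (b : Fin J → ℝ)
    (P : Fin M → Matrix n n ℂ) : Prop :=
  IsPOVM P ∧ ∀ j, ∑ m, ((a j m * P m).trace).re ≤ b j

/-- The primal objective `f(Π)`. -/
def primalObj {n : Type*} [Fintype n] {M : ℕ}
    (c : Fin M → Matrix n n ℂ) (P : Fin M → Matrix n n ℂ) : ℝ :=
  ∑ m, ((c m * P m).trace).re

/-- The operator `z m λ = c m - ∑ j, λ j • a j m`. -/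
def zOp {M J : ℕ} {n : Type*}
    (c : Fin M → Matrix n n ℂ) (a : Fin J → Fin M → Matrix n n ℂ)
    (lam : Fin J → ℝ) (m : Fin M) : Matrix n n ℂ :=
  c m - ∑ j, (lam j : ℂ) • a j m

/-- The dual objective `s(X, λ)`. -/
def dualObj {n : Type*} [Fintype n] {J : ℕ}
    (b : Fin J → ℝ) (X : Matrix n n ℂ) (lam : Fin J → ℝ) : ℝ :=
  X.trace.re + ∑ j, lam j * b j

/-- Dual feasibility: `X` Hermitian, `λ ≥ 0`, and `X - z m λ` positive semidefinite. -/
def DualFeasible {n : Type*} [Fintype n] {M J : ℕ}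
    (c : Fin M → Matrix n n ℂ) (a : Fin J → Fin M → Matrix n n ℂ)
    (X : Matrix n n ℂ) (lam : Fin J → ℝ) : Prop :=
  X.IsHermitian ∧ (∀ j, 0 ≤ lam j) ∧ ∀ m, (X - zOp c a lam m).PosSemidef


section helpers

open scoped Matrix.Norms.L2Operator MatrixOrder in
/-- trace pairing of PSD matrices is nonnegative -/
theorem aux_trace_nonneg {n : Type*} [Fintype n] [DecidableEq n] {A B : Matrix n n ℂ}
    (hA : A.PosSemidef) (hB : B.PosSemidef) : 0 ≤ ((A * B).trace).re := by
  obtain ⟨C, rfl⟩ := CStarAlgebra.nonneg_iff_eq_star_mul_self.1 hB.nonneg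
  rw [Matrix.star_eq_conjTranspose]
  rw [← Matrix.mul_assoc, Matrix.trace_mul_comm, ← Matrix.mul_assoc]
  exact (Complex.le_def.1 (hA.mul_mul_conjTranspose_same C).trace_nonneg).1

theorem aux_psd {n : Type*} [Fintype n] [DecidableEq n] {Q : Matrix n n ℂ}
    (hQ : Q.IsHermitian)
    (h : ∀ P : Matrix n n ℂ, P.PosSemidef → 0 ≤ ((Q * P).trace).re) : Q.PosSemidef := by
  refine Matrix.PosSemidef.of_dotProduct_mulVec_nonneg hQ fun v => ?_
  have h1 := h _ (Matrix.posSemidef_vecMulVec_self_star v)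
  rw [Matrix.mul_vecMulVec, Matrix.trace_vecMulVec, dotProduct_comm] at h1
  refine Complex.le_def.2 ⟨by simpa using h1, ?_⟩
  have := hQ.im_star_dotProduct_mulVec_self v
  simpa using this.symm

theorem aux_repr {n : Type*} [Fintype n] [DecidableEq n] (g : Matrix n n ℂ →ₗ[ℝ] ℝ) :
    ∃ X : Matrix n n ℂ, X.IsHermitian ∧
      ∀ H : Matrix n n ℂ, H.IsHermitian → g H = ((X * H).trace).re := by
  let Y : Matrix n n ℂ := fun j i => (⟨g (Matrix.single i j 1), - g (Matrix.single i j I)⟩ : ℂ)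
  have hY : ∀ H : Matrix n n ℂ, g H = ((Y * H).trace).re := by
    intro H
    conv_lhs => rw [Matrix.matrix_eq_sum_single H]
    have : ∀ i j, g (Matrix.single i j (H i j)) = (Y j i * H i j).re := by
      intro i j
      have e : Matrix.single i j (H i j) =
          (H i j).re • Matrix.single i j (1 : ℂ) + (H i j).im • Matrix.single i j I := by
        rw [Matrix.smul_single, Matrix.smul_single, ← Matrix.single_add]
        congr 1
        apply Complex.ext <;> simp
      rw [e, map_add, map_smul, map_smul]
      simp [Y]
      ring
    simp only [map_sum, this, Matrix.trace, Matrix.diag, Matrix.mul_apply, Complex.re_sum]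
    exact Finset.sum_comm
  refine ⟨(2⁻¹ : ℝ) • (Y + Yᴴ), ?_, ?_⟩
  · unfold Matrix.IsHermitian
    rw [Matrix.conjTranspose_smul, Matrix.conjTranspose_add, Matrix.conjTranspose_conjTranspose,
      add_comm]
    simp
  · intro H hH
    have : ((Yᴴ * H).trace).re = ((Y * H).trace).re := by
      have e : Yᴴ * H = (H * Y)ᴴ := by rw [Matrix.conjTranspose_mul, hH.eq]
      rw [e, Matrix.trace_conjTranspose, Matrix.trace_mul_comm H Y]
      simp
    rw [hY, Matrix.smul_mul, Matrix.trace_smul, Matrix.add_mul, Matrix.trace_add]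
    simp [this]
    ring

theorem aux_weak {n : Type*} [Fintype n] [DecidableEq n] {M J : ℕ}
    {c : Fin M → Matrix n n ℂ} {a : Fin J → Fin M → Matrix n n ℂ} {b : Fin J → ℝ}
    {P : Fin M → Matrix n n ℂ} (hP : Feasible a b P) {X : Matrix n n ℂ} {lam : Fin J → ℝ}
    (hX : DualFeasible c a X lam) : primalObj c P ≤ dualObj b X lam := by
  obtain ⟨⟨hP, h1⟩, hb⟩ := hP
  obtain ⟨-, hl, hX⟩ := hX
  have h0 : 0 ≤ ∑ m, (((X - zOp c a lam m) * P m).trace).re :=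
    Finset.sum_nonneg fun m _ => aux_trace_nonneg (hX m) (hP m)
  have e : ∑ m, (((X - zOp c a lam m) * P m).trace).re =
      X.trace.re - primalObj c P + ∑ j, lam j * ∑ m, ((a j m * P m).trace).re := by
    have e1 : X.trace.re = ∑ m, ((X * P m).trace).re := by
      rw [← Complex.re_sum, ← Matrix.trace_sum, ← Matrix.mul_sum, h1, Matrix.mul_one]
    simp only [Finset.mul_sum]
    rw [Finset.sum_comm, e1, primalObj, ← Finset.sum_sub_distrib, ← Finset.sum_add_distrib]
    refine Finset.sum_congr rfl fun m _ => ?_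
    simp [zOp, Matrix.sub_mul, Matrix.sum_mul, Matrix.trace_sum]
    ring
  have h2 : ∑ j, lam j * ∑ m, ((a j m * P m).trace).re ≤ ∑ j, lam j * b j :=
    Finset.sum_le_sum fun j _ => mul_le_mul_of_nonneg_left (hb j) (hl j)
  unfold dualObj
  linarith

open scoped Matrix.Norms.L2Operator MatrixOrder

theorem aux_norm_le {n : Type*} [Fintype n] [DecidableEq n] {M : ℕ}
    {P : Fin M → Matrix n n ℂ} (hP : ∀ m, (P m).PosSemidef) : ‖P‖ ≤ ‖∑ m, P m‖ := by
  refine (pi_norm_le_iff_of_nonneg (norm_nonneg _)).2 fun m => ?_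
  refine CStarAlgebra.norm_le_norm_of_nonneg_of_le (hP m).nonneg ?_
  exact Finset.single_le_sum (f := P) (fun i _ => (hP i).nonneg) (Finset.mem_univ m)

theorem aux_dual_ne {n : Type*} [Fintype n] [DecidableEq n] {M J : ℕ}
    (c : Fin M → Matrix n n ℂ) (a : Fin J → Fin M → Matrix n n ℂ)
    (hc : ∀ m, (c m).IsHermitian) : ∃ X lam, DualFeasible c a X lam := by
  refine ⟨algebraMap ℝ _ (∑ m, ‖c m‖), 0, ?_, by simp, fun m => ?_⟩
  · exact IsSelfAdjoint.algebraMap _ (IsSelfAdjoint.all _)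
  · have : zOp c a 0 m = c m := by simp [zOp]
    rw [this, ← Matrix.le_iff]
    refine (IsSelfAdjoint.le_algebraMap_norm_self (hc m)).trans ?_
    refine algebraMap_mono _ ?_
    exact Finset.single_le_sum (f := fun m => ‖c m‖) (fun i _ => norm_nonneg _) (Finset.mem_univ m)

/-- the cone of achievable values -/
def auxCone {n : Type*} [Fintype n] [DecidableEq n] {M J : ℕ}
    (c : Fin M → Matrix n n ℂ) (a : Fin J → Fin M → Matrix n n ℂ) :
    Set (Matrix n n ℂ × (Fin J → ℝ) × ℝ) :=
  {x | ∃ P : Fin M → Matrix n n ℂ, (∀ m, (P m).PosSemidef) ∧ ∑ m, P m = x.1 ∧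
    (∀ j, ∑ m, ((a j m * P m).trace).re ≤ x.2.1 j) ∧ x.2.2 ≤ primalObj c P}

theorem aux_cone_closed {n : Type*} [Fintype n] [DecidableEq n] {M J : ℕ}
    (c : Fin M → Matrix n n ℂ) (a : Fin J → Fin M → Matrix n n ℂ) :
    IsClosed (auxCone c a) := by
  refine IsSeqClosed.isClosed ?_
  intro x y hx hxy
  choose P hP h1 h2 h3 using hx
  have hbd : ∃ R, ∀ k, P k ∈ Metric.closedBall (0 : Fin M → Matrix n n ℂ) R := by
    obtain ⟨R, hR⟩ := (Metric.isBounded_range_of_tendsto _ hxy.fst_nhds).exists_norm_le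
    refine ⟨R, fun k => ?_⟩
    rw [mem_closedBall_zero_iff]
    refine (aux_norm_le (hP k)).trans ?_
    rw [h1 k]
    exact hR _ ⟨k, rfl⟩
  obtain ⟨R, hR⟩ := hbd
  have : ProperSpace (Fin M → Matrix n n ℂ) := FiniteDimensional.proper ℂ _
  obtain ⟨Q, -, φ, hφ, hQ⟩ := (isCompact_closedBall (0 : Fin M → Matrix n n ℂ) R).tendsto_subseq hR
  have hy := hxy.comp hφ.tendsto_atTop
  have hQm : ∀ m, Filter.Tendsto (fun k => P (φ k) m) Filter.atTop (nhds (Q m)) := fun m =>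
    (tendsto_pi_nhds.1 hQ) m
  have htr : ∀ (A : Fin M → Matrix n n ℂ), Filter.Tendsto
      (fun k => ∑ m, ((A m * P (φ k) m).trace).re) Filter.atTop
      (nhds (∑ m, ((A m * Q m).trace).re)) := by
    intro A
    have hcont : Continuous fun P : Fin M → Matrix n n ℂ => ∑ m, ((A m * P m).trace).re := by
      fun_prop
    exact (hcont.tendsto Q).comp hQ
  refine ⟨Q, fun m => ?_, ?_, fun j => ?_, ?_⟩
  · have hcl : IsClosed {A : Matrix n n ℂ | 0 ≤ A} := isClosed_Ici
    have := hcl.mem_of_tendsto (hQm m) (Filter.Eventually.of_forall fun k => (hP (φ k) m).nonneg)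
    exact Matrix.nonneg_iff_posSemidef.1 this
  · refine tendsto_nhds_unique (tendsto_finsetSum _ fun m _ => hQm m) ?_
    simp only [h1]
    exact hy.fst_nhds
  · exact le_of_tendsto_of_tendsto' (htr (a j)) ((tendsto_pi_nhds.1 hy.snd_nhds.fst_nhds) j)
      fun k => h2 _ j
  · exact le_of_tendsto_of_tendsto' hy.snd_nhds.snd_nhds (htr c) fun k => h3 _

theorem aux_lin {n : Type*} [Fintype n] [DecidableEq n] {M : ℕ} 
    (A P Q : Fin M → Matrix n n ℂ) (s t : ℝ) :
    ∑ m, ((A m * (s • P + t • Q) m).trace).re =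
      s * ∑ m, ((A m * P m).trace).re + t * ∑ m, ((A m * Q m).trace).re := by
  simp [Matrix.mul_add, Finset.sum_add_distrib, Finset.mul_sum]

theorem aux_cone_comb {n : Type*} [Fintype n] [DecidableEq n] {M J : ℕ}
    (c : Fin M → Matrix n n ℂ) (a : Fin J → Fin M → Matrix n n ℂ) {x y}
    (hx : x ∈ auxCone c a) (hy : y ∈ auxCone c a) {s t : ℝ} (hs : 0 ≤ s) (ht : 0 ≤ t) :
    s • x + t • y ∈ auxCone c a := by
  obtain ⟨P, hP, h1, h2, h3⟩ := hx
  obtain ⟨Q, hQ, g1, g2, g3⟩ := hy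
  refine ⟨s • P + t • Q, fun m => ((hP m).smul hs).add ((hQ m).smul ht), ?_, fun j => ?_, ?_⟩
  · simp [← h1, ← g1, Finset.sum_add_distrib, Finset.smul_sum]
  · rw [aux_lin]
    exact add_le_add (mul_le_mul_of_nonneg_left (h2 j) hs) (mul_le_mul_of_nonneg_left (g2 j) ht)
  · rw [primalObj, aux_lin]
    exact add_le_add (mul_le_mul_of_nonneg_left h3 hs) (mul_le_mul_of_nonneg_left g3 ht)

theorem aux_strong {n : Type*} [Fintype n] [DecidableEq n]
    {M J : ℕ}
    (c : Fin M → Matrix n n ℂ) (a : Fin J → Fin M → Matrix n n ℂ) (b : Fin J → ℝ)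
    (hc : ∀ m, (c m).IsHermitian) (ha : ∀ j m, (a j m).IsHermitian)
    (hne : ∃ P, Feasible a b P) (t : ℝ) (ht : ∀ P, Feasible a b P → primalObj c P < t) :
    ∃ X lam, DualFeasible c a X lam ∧ dualObj b X lam < t := by
  have hnot : ((1 : Matrix n n ℂ), b, t) ∉ auxCone c a := by
    rintro ⟨P, hP, h1, h2, h3⟩
    exact absurd (ht P ⟨⟨hP, h1⟩, h2⟩) (not_lt.2 h3)
  have hzero : (0 : Matrix n n ℂ × (Fin J → ℝ) × ℝ) ∈ auxCone c a :=
    ⟨0, fun m => Matrix.PosSemidef.zero, by simp, by simp, by simp [primalObj]⟩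
  obtain ⟨F, u, hFu, hF⟩ := geometric_hahn_banach_point_closed
    (fun x hx y hy s t hs ht _ => aux_cone_comb c a hx hy hs ht) (aux_cone_closed c a) hnot
  have hu : u < 0 := by simpa using hF 0 hzero
  have hpos : ∀ x ∈ auxCone c a, 0 ≤ F x := by
    intro x hx
    by_contra! hlt
    have := hF _ (aux_cone_comb c a hx hzero (div_nonneg_of_nonpos hu.le hlt.le) le_rfl)
    simp [div_mul_cancel₀ _ hlt.ne] at this
  obtain ⟨X, hX, hXg⟩ := aux_repr (F.toLinearMap ∘ₗ LinearMap.inl ℝ _ _)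
  set μ : Fin J → ℝ := fun j => F (0, Pi.single j 1, 0) with hμ
  set ν : ℝ := - F (0, 0, 1) with hν
  have hrep : ∀ (H : Matrix n n ℂ) v s, H.IsHermitian →
      F (H, v, s) = ((X * H).trace).re + ∑ j, μ j * v j - ν * s := by
    intro H v s hH
    have e1 : ((H, v, s) : Matrix n n ℂ × (Fin J → ℝ) × ℝ) =
      (H, 0, 0) + ∑ j, v j • ((0, Pi.single j 1, 0) : Matrix n n ℂ × (Fin J → ℝ) × ℝ)
        + s • (0, 0, 1) := by
      refine Prod.ext ?_ (Prod.ext ?_ ?_)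
      · simp [Prod.fst_sum]
      · ext k
        simp [Prod.fst_sum, Prod.snd_sum, Pi.single_apply]
      · simp [Prod.snd_sum]
    have e2 : F (H, 0, 0) = ((X * H).trace).re := by
      rw [← hXg H hH]; rfl
    rw [e1, map_add, map_add, map_sum, e2, map_smul]
    simp only [map_smul, smul_eq_mul, hμ, hν]
    simp only [mul_comm (v _)]
    ring
  have hν0 : 0 ≤ ν := by
    have h := hpos (0, 0, -1) ⟨0, fun m => Matrix.PosSemidef.zero, by simp, by simp, by simp [primalObj]⟩
    rw [hrep _ _ _ Matrix.isHermitian_zero] at h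
    simpa using h
  have hμ0 : ∀ j, 0 ≤ μ j := by
    intro j
    refine hpos _ ⟨0, fun m => Matrix.PosSemidef.zero, by simp, fun k => ?_, by simp [primalObj]⟩
    by_cases h : k = j
    · subst h; simp
    · simp [h]
  rw [hrep _ _ _ Matrix.isHermitian_one, Matrix.mul_one] at hFu
  have hνpos : 0 < ν := by
    refine lt_of_le_of_ne hν0 fun h0 => ?_
    obtain ⟨P, hP⟩ := hne
    have h := hpos (1, b, primalObj c P) ⟨P, hP.1.1, hP.1.2, hP.2, le_rfl⟩
    rw [hrep _ _ _ Matrix.isHermitian_one, Matrix.mul_one] at h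
    rw [← h0] at h hFu
    linarith
  have hz : ∀ l m, (zOp c a l m).IsHermitian := by
    intro l m
    refine (hc m).sub ?_
    unfold Matrix.IsHermitian
    rw [Matrix.conjTranspose_sum]
    refine Finset.sum_congr rfl fun j _ => ?_
    rw [Matrix.conjTranspose_smul, (ha j m).eq]
    simp
  have hXh : (ν⁻¹ • X).IsHermitian := by
    unfold Matrix.IsHermitian
    rw [Matrix.conjTranspose_smul, hX.eq]; simp
  refine ⟨ν⁻¹ • X, fun j => ν⁻¹ * μ j, ⟨hXh, fun j => mul_nonneg (inv_nonneg.2 hν0) (hμ0 j), fun m => ?_⟩, ?_⟩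
  · refine aux_psd (hXh.sub (hz _ _)) fun P hP => ?_
    have hs : ∀ A : Fin M → Matrix n n ℂ,
        ∑ k, ((A k * (Pi.single m P : Fin M → Matrix n n ℂ) k).trace).re = ((A m * P).trace).re := by
      intro A
      rw [Finset.sum_eq_single m]
      · simp
      · intro k _ hk; simp [hk]
      · simp
    have h := hpos (P, (fun j => ((a j m * P).trace).re), ((c m * P).trace).re)
      ⟨Pi.single m P, fun k => ?_, by simp, fun j => (hs (a j)).le, (hs c).ge⟩
    · rw [hrep _ _ _ hP.1] at h
      have := mul_nonneg (inv_nonneg.2 hν0) h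
      have e : (((ν⁻¹ • X - zOp c a (fun j => ν⁻¹ * μ j) m) * P).trace).re =
        ν⁻¹ * (((X * P).trace).re + ∑ j, μ j * ((a j m * P).trace).re - ν * ((c m * P).trace).re) := by
        rw [mul_sub, ← mul_assoc, inv_mul_cancel₀ hνpos.ne', mul_add, Finset.mul_sum]
        have e3 : ∀ j, ((((ν⁻¹ * μ j : ℝ) : ℂ) • a j m * P).trace).re
            = ν⁻¹ * (μ j * ((a j m * P).trace).re) := by
          intro j
          rw [Matrix.smul_mul, Matrix.trace_smul, smul_eq_mul, Complex.re_ofReal_mul, mul_assoc]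
        rw [zOp, Matrix.sub_mul, Matrix.sub_mul, Matrix.sum_mul, Matrix.trace_sub,
          Matrix.trace_sub, Matrix.trace_sum, Complex.sub_re, Complex.sub_re, Complex.re_sum,
          Finset.sum_congr rfl fun j _ => e3 j, Matrix.smul_mul, Matrix.trace_smul,
          Complex.smul_re, smul_eq_mul]
        ring
      rw [e]; exact this
    · by_cases hk : k = m
      · subst hk; simpa using hP
      · simpa [hk] using Matrix.PosSemidef.zero
  · have e : dualObj b (ν⁻¹ • X) (fun j => ν⁻¹ * μ j) = ν⁻¹ * (X.trace.re + ∑ j, μ j * b j) := by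
      rw [dualObj, mul_add, Finset.mul_sum, Matrix.trace_smul, Complex.smul_re, smul_eq_mul]
      simp only [mul_assoc]
    rw [e, inv_mul_lt_iff₀ hνpos]
    linarith

end helpers

/-- Strong duality (Theorem 1): if the feasible set is nonempty, the optimal values
of the primal and dual problems coincide. -/
theorem strong_duality {n : Type*} [Fintype n] [DecidableEq n] [Nonempty n]
    {M J : ℕ}
    (c : Fin M → Matrix n n ℂ) (a : Fin J → Fin M → Matrix n n ℂ) (b : Fin J → ℝ)
    (hc : ∀ m, (c m).IsHermitian) (ha : ∀ j m, (a j m).IsHermitian)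
    (hne : ∃ P, Feasible a b P) :
    sSup ((fun P => primalObj c P) '' {P | Feasible a b P}) =
      sInf ((fun Xlam : Matrix n n ℂ × (Fin J → ℝ) => dualObj b Xlam.1 Xlam.2) ''
        {Xlam | DualFeasible c a Xlam.1 Xlam.2}) := by
  obtain ⟨X₀, l₀, h₀⟩ := aux_dual_ne c a hc
  obtain ⟨P₀, hP₀⟩ := id hne
  have hbdd : BddAbove ((fun P => primalObj c P) '' {P | Feasible a b P}) := by
    refine ⟨dualObj b X₀ l₀, ?_⟩
    rintro _ ⟨P, hP, rfl⟩
    exact aux_weak hP h₀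
  apply le_antisymm
  · refine csSup_le ⟨_, P₀, hP₀, rfl⟩ ?_
    rintro _ ⟨P, hP, rfl⟩
    refine le_csInf ⟨_, (X₀, l₀), h₀, rfl⟩ ?_
    rintro _ ⟨⟨X, l⟩, h, rfl⟩
    exact aux_weak hP h
  · refine le_of_forall_gt fun t ht => ?_
    obtain ⟨X, l, h, hlt⟩ := aux_strong c a b hc ha hne t
      fun P hP => (le_csSup hbdd ⟨P, hP, rfl⟩).trans_lt ht
    refine lt_of_le_of_lt (csInf_le ⟨primalObj c P₀, ?_⟩ ⟨(X, l), h, rfl⟩) hlt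
    rintro _ ⟨⟨X, l⟩, h, rfl⟩
    exact aux_weak hP₀ h
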